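/- Let A ⊆ B be ideals of a finite-dimensional n-Lie algebra L. Suppose that B/A is 2-nilpotently embedded in L/A and that A ⊆ Φ(L). Then B is 2-nilpotently embedded in L. -/

import Mathlib

namespace NLie

open Finset

variable {F : Type*} [Field F] {L : Type*} [AddCommGroup L] [Module F L] {n : ℕ}

/-- The generalized Jacobi identity for an `(n+2)`-ary alternating bracket:
`[y₁,…,y_{n+1},[x₁,…,x_{n+2}]] = ∑ᵢ [x₁,…,[y₁,…,y_{n+1},xᵢ],…,x_{n+2}]`.
(This is the identity (1) of the paper, rewritten with the string `y` in the
first `n+1` slots, which is equivalent since the bracket is alternating.) -/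
def IsNLie (f : AlternatingMap F L L (Fin (n + 2))) : Prop :=
  ∀ (y : Fin (n + 1) → L) (x : Fin (n + 2) → L),
    f (Fin.snoc y (f x)) = ∑ i, f (Function.update x i (f (Fin.snoc y (x i))))

/-- `d : L → L` is a derivation of the bracket `f`. -/
def IsDerivation (f : AlternatingMap F L L (Fin (n + 2))) (d : L →ₗ[F] L) : Prop :=
  ∀ x : Fin (n + 2) → L, d (f x) = ∑ i, f (Function.update x i (d (x i)))

/-- The (inner) derivation `D(a₁,…,a_{n+1}) : x ↦ [a₁,…,a_{n+1},x]`. -/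
def D (f : AlternatingMap F L L (Fin (n + 2))) (a : Fin (n + 1) → L) : L →ₗ[F] L where
  toFun x := f (Fin.snoc a x)
  map_add' x y := by
    have h := f.toMultilinearMap.map_update_add (Fin.snoc a x) (Fin.last (n + 1)) x y
    simpa [Fin.update_snoc_last] using h
  map_smul' c x := by
    have h := f.toMultilinearMap.map_update_smul (Fin.snoc a x) (Fin.last (n + 1)) c x
    simpa [Fin.update_snoc_last] using h

/-- `D(U)`: the span of all inner derivations `D(a₁,…,a_{n+1})` with all `aᵢ ∈ U`. -/
def Dspan (f : AlternatingMap F L L (Fin (n + 2))) (U : Submodule F L) :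
    Submodule F (L →ₗ[F] L) :=
  Submodule.span F {d | ∃ a : Fin (n + 1) → L, (∀ i, a i ∈ U) ∧ d = D f a}

/-- The Engel subspace `E_L(d) = {x ∈ L ∣ dʳ x = 0 for some r}`. -/
def engel (d : L →ₗ[F] L) : Submodule F L where
  carrier := {x | ∃ r, (d ^ r) x = 0}
  zero_mem' := ⟨0, map_zero _⟩
  add_mem' := by
    rintro a b ⟨r, hr⟩ ⟨s, hs⟩
    refine ⟨r + s, ?_⟩
    have h1 : (d ^ (r + s)) a = (d ^ s) ((d ^ r) a) := by
      rw [add_comm r s, pow_add]; rfl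
    have h2 : (d ^ (r + s)) b = (d ^ r) ((d ^ s) b) := by
      rw [pow_add]; rfl
    rw [map_add, h1, h2, hr, hs, map_zero, map_zero, add_zero]
  smul_mem' := by
    rintro c a ⟨r, hr⟩
    exact ⟨r, by rw [map_smul, hr, smul_zero]⟩

/-- `E` is an Engel subalgebra of `L`: `E = E_L(d)` for some inner derivation `d ∈ D(E)`. -/
def IsEngel (f : AlternatingMap F L L (Fin (n + 2))) (E : Submodule F L) : Prop :=
  ∃ d : L →ₗ[F] L, d ∈ Dspan f E ∧ E = engel d

/-- `[A₁,…,A_{n+2}]`: the subspace spanned by all brackets with `aᵢ ∈ Aᵢ`. -/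
def bracketSpan (f : AlternatingMap F L L (Fin (n + 2))) (A : Fin (n + 2) → Submodule F L) :
    Submodule F L :=
  Submodule.span F {z | ∃ a : Fin (n + 2) → L, (∀ i, a i ∈ A i) ∧ f a = z}

/-- `K` is a subalgebra of `L`. -/
def IsSubalg (f : AlternatingMap F L L (Fin (n + 2))) (K : Submodule F L) : Prop :=
  ∀ a : Fin (n + 2) → L, (∀ i, a i ∈ K) → f a ∈ K

/-- `K` is an ideal of `L` : `[K,L,…,L] ⊆ K`. -/
def IsIdeal (f : AlternatingMap F L L (Fin (n + 2))) (K : Submodule F L) : Prop :=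
  ∀ a : Fin (n + 2) → L, a 0 ∈ K → f a ∈ K

/-- `V` is an ideal of the subalgebra `W`. -/
def IsIdealIn (f : AlternatingMap F L L (Fin (n + 2))) (V W : Submodule F L) : Prop :=
  V ≤ W ∧ ∀ a : Fin (n + 2) → L, a 0 ∈ V → (∀ i, a i ∈ W) → f a ∈ V

/-- `M` is a maximal proper subalgebra of `L`. -/
def IsMaximalSubalg (f : AlternatingMap F L L (Fin (n + 2))) (M : Submodule F L) : Prop :=
  IsSubalg f M ∧ M ≠ ⊤ ∧ ∀ U : Submodule F L, IsSubalg f U → M < U → U = ⊤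

/-- The Frattini subalgebra: the intersection of all maximal proper subalgebras. -/
def frattini (f : AlternatingMap F L L (Fin (n + 2))) : Submodule F L :=
  sInf {M | IsMaximalSubalg f M}

/-- The lower central series of a subalgebra `U`:
`U¹ = U`, `U^{s+1} = [Uˢ, U,…,U]`. (`lcsIn f U s` is `U^{s+1}`.) -/
def lcsIn (f : AlternatingMap F L L (Fin (n + 2))) (U : Submodule F L) : ℕ → Submodule F L
  | 0 => U
  | s + 1 => bracketSpan f (Fin.cons (lcsIn f U s) fun _ => U)

/-- `L` is a nilpotent `(n+2)`-Lie algebra. -/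
def IsNilpotentAlg (f : AlternatingMap F L L (Fin (n + 2))) : Prop :=
  ∃ r, lcsIn f ⊤ r = ⊥

/-- The lower central series of `U` modulo `K`: `U/K` is nilpotent iff some term
of this series is contained in `K`. -/
def lcsMod (f : AlternatingMap F L L (Fin (n + 2))) (U K : Submodule F L) : ℕ → Submodule F L
  | 0 => U
  | s + 1 => bracketSpan f (Fin.cons (lcsMod f U K s) fun _ => U) ⊔ K

/-- The series `K¹ = K`, `K^{s+1} = [Kˢ, K, L,…,L]` used to define
"2-nilpotently embedded". -/
def nes2 (f : AlternatingMap F L L (Fin (n + 2))) (K : Submodule F L) : ℕ → Submodule F L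
  | 0 => K
  | s + 1 => bracketSpan f (Fin.cons (nes2 f K s) (Fin.cons K fun _ => ⊤))

/-- The series of `B` modulo `A`, so that `B/A` is 2-nilpotently embedded in `L/A`
iff some term of this series is contained in `A`. -/
def nes2Mod (f : AlternatingMap F L L (Fin (n + 2))) (B A : Submodule F L) : ℕ → Submodule F L
  | 0 => B
  | s + 1 => bracketSpan f (Fin.cons (nes2Mod f B A s) (Fin.cons B fun _ => ⊤)) ⊔ A

/-- The 2-derived series: `L⁽⁰⁾ = L`, `L⁽ˢ⁺¹⁾ = [L⁽ˢ⁾, L⁽ˢ⁾, L,…,L]`. -/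
def ds2 (f : AlternatingMap F L L (Fin (n + 2))) : ℕ → Submodule F L
  | 0 => ⊤
  | s + 1 => bracketSpan f (Fin.cons (ds2 f s) (Fin.cons (ds2 f s) fun _ => ⊤))

/-- `L` is 2-soluble. -/
def Is2Soluble (f : AlternatingMap F L L (Fin (n + 2))) : Prop :=
  ∃ r, ds2 f r = ⊥

/-- The `k`-derived series of an ideal `K`:
`K⁽⁰⁾ = K`, `K⁽ˢ⁺¹⁾ = [(k)K⁽ˢ⁾, (n+2-k)L]`: `K` is `k`-solubly embedded in `L`
iff some term vanishes. -/
def dsk (f : AlternatingMap F L L (Fin (n + 2))) (k : ℕ) (K : Submodule F L) :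
    ℕ → Submodule F L
  | 0 => K
  | s + 1 => bracketSpan f (fun i => if (i : ℕ) < k then dsk f k K s else ⊤)

/-- The `k`-derived series of `A` modulo `B`: `A/B` is `k`-solubly embedded in `L/B`
iff some term of this series is contained in `B`. -/
def dskMod (f : AlternatingMap F L L (Fin (n + 2))) (k : ℕ) (A B : Submodule F L) :
    ℕ → Submodule F L
  | 0 => A
  | s + 1 => bracketSpan f (fun i => if (i : ℕ) < k then dskMod f k A B s else ⊤) ⊔ B

/-- The ideal `A` is abelian embedded in `L`: `[A,A,L,…,L] = 0`. -/
def IsAbelianEmbedded (f : AlternatingMap F L L (Fin (n + 2))) (A : Submodule F L) : Prop :=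
  ∀ a : Fin (n + 2) → L, a 0 ∈ A → a 1 ∈ A → f a = 0

/-- `A` is a minimal abelian embedded ideal of `L`: a nonzero abelian embedded ideal
whose only properly contained ideal is `0`. -/
def IsMinAbelianEmbeddedIdeal (f : AlternatingMap F L L (Fin (n + 2)))
    (A : Submodule F L) : Prop :=
  A ≠ ⊥ ∧ IsIdeal f A ∧ IsAbelianEmbedded f A ∧
    ∀ B : Submodule F L, IsIdeal f B → B < A → B = ⊥

/-- The normalizer `N_L(U) = {x ∈ L ∣ [x,u₁,…,u_{n+1}] ∈ U for all uᵢ ∈ U}`. -/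
def normalizer (f : AlternatingMap F L L (Fin (n + 2))) (U : Submodule F L) : Set L :=
  {x | ∀ u : Fin (n + 1) → L, (∀ i, u i ∈ U) → f (Fin.cons x u) ∈ U}

/-- The centralizer `C_L(A) = {c ∈ L ∣ [c,a,x₃,…,x_{n+2}] = 0 for all a ∈ A, xᵢ ∈ L}`. -/
def centralizer (f : AlternatingMap F L L (Fin (n + 2))) (A : Submodule F L) : Set L :=
  {c | ∀ a ∈ A, ∀ x : Fin n → L, f (Fin.cons c (Fin.cons a x)) = 0}

/-- `S` is a Cartan subalgebra of `L`: a nilpotent self-normalizing subalgebra. -/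
def IsCartan (f : AlternatingMap F L L (Fin (n + 2))) (S : Submodule F L) : Prop :=
  IsSubalg f S ∧ (∃ r, lcsIn f S r = ⊥) ∧ normalizer f S = (S : Set L)

/-- `U` is a subnormal subalgebra of `L`. -/
def IsSubnormal (f : AlternatingMap F L L (Fin (n + 2))) (U : Submodule F L) : Prop :=
  ∃ (r : ℕ) (C : ℕ → Submodule F L), C 0 = U ∧ C r = ⊤ ∧
    (∀ i ≤ r, IsSubalg f (C i)) ∧ ∀ i < r, IsIdealIn f (C i) (C (i + 1))

/-- An `A`-inner automorphism: a finite product of maps `1 + D(a,x₂,…,x_{n+1})`,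
`a ∈ A`, where `A` is an abelian embedded ideal. -/
def IsAInner (f : AlternatingMap F L L (Fin (n + 2))) (A : Submodule F L)
    (α : L →ₗ[F] L) : Prop :=
  ∃ (m : ℕ) (g : Fin m → (L →ₗ[F] L)),
    (∀ j, ∃ (a : L) (x : Fin n → L), a ∈ A ∧ g j = LinearMap.id + D f (Fin.cons a x)) ∧
    α = (List.ofFn g).prod


theorem mem_engel {d : L →ₗ[F] L} {x : L} : x ∈ engel d ↔ ∃ r, (d ^ r) x = 0 := Iff.rfl

theorem mem_engel_of_apply_mem {d : L →ₗ[F] L} {x : L} (h : d x ∈ engel d) : x ∈ engel d := by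
  obtain ⟨r, hr⟩ := h
  exact ⟨r + 1, by rw [pow_succ, Module.End.mul_apply, hr]⟩

/-- The Engel subspace of a derivation is a subalgebra. -/
theorem IsDerivation.isSubalg_engel {f : AlternatingMap F L L (Fin (n + 2))} {d : L →ₗ[F] L}
    (hd : IsDerivation f d) : IsSubalg f (engel d) := by
  have key : ∀ (N : ℕ) (k : Fin (n + 2) → ℕ) (x : Fin (n + 2) → L),
      ∑ i, k i ≤ N → (∀ i, (d ^ k i) (x i) = 0) → f x ∈ engel d := by
    intro N
    induction N with
    | zero =>
      intro k x hk hx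
      have h0 : k 0 = 0 := by
        have := Finset.single_le_sum (f := k) (fun _ _ => Nat.zero_le _) (Finset.mem_univ 0)
        omega
      have hx0 : x 0 = 0 := by simpa [h0] using hx 0
      rw [f.map_coord_zero 0 hx0]
      exact zero_mem _
    | succ N ih =>
      intro k x hk hx
      by_cases hz : ∃ i, k i = 0
      · obtain ⟨i, hi⟩ := hz
        have hxi : x i = 0 := by simpa [hi] using hx i
        rw [f.map_coord_zero i hxi]
        exact zero_mem _
      · push Not at hz
        apply mem_engel_of_apply_mem
        rw [hd x]
        refine sum_mem fun i _ => ih (Function.update k i (k i - 1)) _ ?_ fun j => ?_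
        · have hlt : ∑ j, Function.update k i (k i - 1) j < ∑ j, k j := by
            refine Finset.sum_lt_sum (fun j _ => ?_) ⟨i, Finset.mem_univ i, ?_⟩
            · rcases eq_or_ne j i with rfl | hj <;> simp [*]
            · have := hz i
              simp only [Function.update_self]
              omega
          omega
        · rcases eq_or_ne j i with rfl | hj
          · have h := hx j
            obtain ⟨m, hm⟩ := Nat.exists_eq_succ_of_ne_zero (hz j)
            rw [hm, Nat.succ_eq_add_one, pow_succ, Module.End.mul_apply] at h
            simpa [hm] using h
          · simpa [hj] using hx j
  intro a ha
  choose k hk using ha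
  exact key _ k a le_rfl hk

theorem D_apply (f : AlternatingMap F L L (Fin (n + 2))) (a : Fin (n + 1) → L) (x : L) :
    D f a x = f (Fin.snoc a x) := rfl

theorem isDerivation_D {f : AlternatingMap F L L (Fin (n + 2))} (hf : IsNLie f)
    (a : Fin (n + 1) → L) : IsDerivation f (D f a) :=
  hf a

theorem IsIdeal.apply_mem {f : AlternatingMap F L L (Fin (n + 2))} {K : Submodule F L}
    (hK : IsIdeal f K) {a : Fin (n + 2) → L} (i : Fin (n + 2)) (hi : a i ∈ K) : f a ∈ K := by
  have h : f (a ∘ Equiv.swap 0 i) ∈ K := hK _ (by simpa using hi)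
  rw [f.map_perm, Units.smul_def] at h
  rcases Int.units_eq_one_or (Equiv.Perm.sign (Equiv.swap 0 i)) with hs | hs <;>
    simpa [hs] using h

/-- Moving the last argument of the bracket to the front. -/
theorem exists_sign_D_apply (f : AlternatingMap F L L (Fin (n + 2))) :
    ∃ ε : ℤˣ, ∀ (a : Fin (n + 1) → L) (x : L), D f a x = ε • f (Fin.cons x a) := by
  refine ⟨Equiv.Perm.sign (finRotate (n + 2)), fun a x => ?_⟩
  rw [D_apply, ← f.map_perm, Fin.snoc_eq_cons_rotate]
  rfl

/-- The span of the inner derivations `D(b, x₂, …, x_{n+1})` with `b ∈ B`. -/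
def innerSpan (f : AlternatingMap F L L (Fin (n + 2))) (B : Submodule F L) :
    Submodule F (Module.End F L) :=
  Submodule.span F {d | ∃ a : Fin (n + 1) → L, a 0 ∈ B ∧ D f a = d}

theorem D_mem_innerSpan (f : AlternatingMap F L L (Fin (n + 2))) {B : Submodule F L}
    {a : Fin (n + 1) → L} (ha : a 0 ∈ B) : D f a ∈ innerSpan f B :=
  Submodule.subset_span ⟨a, ha, rfl⟩

theorem isDerivation_of_mem_innerSpan {f : AlternatingMap F L L (Fin (n + 2))} (hf : IsNLie f)
    {B : Submodule F L} {d : Module.End F L} (hd : d ∈ innerSpan f B) : IsDerivation f d := by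
  induction hd using Submodule.span_induction with
  | mem d hd =>
    obtain ⟨a, -, rfl⟩ := hd
    exact isDerivation_D hf a
  | zero => intro x; simp
  | add d e _ _ hd he =>
    intro x
    simp [hd x, he x, Finset.sum_add_distrib]
  | smul c d _ hd =>
    intro x
    simp [hd x, Finset.smul_sum]

attribute [local instance] LieRing.ofAssociativeRing

theorem IsDerivation.lie_D {f : AlternatingMap F L L (Fin (n + 2))} {d : Module.End F L}
    (hd : IsDerivation f d) (a : Fin (n + 1) → L) :
    ⁅d, D f a⁆ = ∑ i, D f (Function.update a i (d (a i))) := by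
  ext x
  have h := hd (Fin.snoc a x)
  rw [Fin.sum_univ_castSucc] at h
  simp only [Fin.snoc_castSucc, Fin.snoc_last, Fin.update_snoc_last, ← Fin.snoc_update] at h
  simp [LieRing.of_associative_ring_bracket, D_apply, h]

theorem apply_mem_of_mem_innerSpan {f : AlternatingMap F L L (Fin (n + 2))} {B : Submodule F L}
    (hB : IsIdeal f B) {d : Module.End F L} (hd : d ∈ innerSpan f B) (x : L) : d x ∈ B := by
  refine (Submodule.span_le (p := B.comap (LinearMap.applyₗ x))).2 ?_ hd
  rintro _ ⟨a, ha, rfl⟩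
  exact hB.apply_mem (Fin.castSucc 0) (by simpa only [Fin.snoc_castSucc] using ha)

/-- The Lie algebra of inner derivations `D(b, x₂, …, x_{n+1})` with `b` in the ideal `B`. -/
def innerSubalgebra {f : AlternatingMap F L L (Fin (n + 2))} (hf : IsNLie f) {B : Submodule F L}
    (hB : IsIdeal f B) : LieSubalgebra F (Module.End F L) where
  __ := innerSpan f B
  lie_mem' := by
    intro d e hd he
    change e ∈ innerSpan f B at he
    change ⁅d, e⁆ ∈ innerSpan f B
    induction he using Submodule.span_induction with
    | mem e he =>
      obtain ⟨a, ha, rfl⟩ := he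
      rw [(isDerivation_of_mem_innerSpan hf hd).lie_D]
      refine sum_mem fun i _ => D_mem_innerSpan f ?_
      rcases eq_or_ne 0 i with rfl | hi
      · simpa using apply_mem_of_mem_innerSpan hB hd (a 0)
      · simpa [hi] using ha
    | zero => simp
    | add e e' _ _ h h' => simpa using add_mem h h'
    | smul c e _ h => simpa using Submodule.smul_mem _ c h

theorem apply_mem_nes2Mod_succ {f : AlternatingMap F L L (Fin (n + 2))} {A B : Submodule F L}
    {d : Module.End F L} (hd : d ∈ innerSpan f B) {s : ℕ} {x : L} (hx : x ∈ nes2Mod f B A s) :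
    d x ∈ nes2Mod f B A (s + 1) := by
  refine (Submodule.span_le (p := (nes2Mod f B A (s + 1)).comap (LinearMap.applyₗ x))).2 ?_ hd
  rintro _ ⟨a, ha, rfl⟩
  obtain ⟨ε, hε⟩ := exists_sign_D_apply f
  have h : f (Fin.cons x a) ∈
      bracketSpan f (Fin.cons (nes2Mod f B A s) (Fin.cons B fun _ => ⊤)) := by
    refine Submodule.subset_span ⟨Fin.cons x a, fun i => ?_, rfl⟩
    refine Fin.cases ?_ (fun j => Fin.cases ?_ (fun j => ?_) j) i
    · simpa using hx
    · simpa using ha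
    · simp
  change D f a x ∈ nes2Mod f B A (s + 1)
  rw [hε, Units.smul_def]
  exact Submodule.mem_sup_left (zsmul_mem h _)

theorem pow_succ_apply_mem_nes2Mod {f : AlternatingMap F L L (Fin (n + 2))} {A B : Submodule F L}
    (hB : IsIdeal f B) {d : Module.End F L} (hd : d ∈ innerSpan f B) (s : ℕ) (x : L) :
    (d ^ (s + 1)) x ∈ nes2Mod f B A s := by
  induction s with
  | zero => simpa [nes2Mod] using apply_mem_of_mem_innerSpan hB hd x
  | succ s ih =>
    rw [pow_succ', Module.End.mul_apply]
    exact apply_mem_nes2Mod_succ hd ih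

/-- A proper subalgebra is contained in a maximal one. -/
theorem exists_isMaximalSubalg_ge [FiniteDimensional F L]
    {f : AlternatingMap F L L (Fin (n + 2))} {E : Submodule F L} (hE : IsSubalg f E)
    (hE' : E ≠ ⊤) : ∃ M, IsMaximalSubalg f M ∧ E ≤ M := by
  obtain ⟨M, ⟨hM, hMt, hEM⟩, hmax⟩ := wellFounded_gt.has_min
    {M : Submodule F L | IsSubalg f M ∧ M ≠ ⊤ ∧ E ≤ M} ⟨E, hE, hE', le_rfl⟩
  refine ⟨M, ⟨hM, hMt, fun U hU hMU => ?_⟩, hEM⟩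
  by_contra hUt
  exact hmax U ⟨hU, hUt, hEM.trans hMU.le⟩ hMU

theorem eq_top_of_sup_eq_top_of_le_frattini [FiniteDimensional F L]
    {f : AlternatingMap F L L (Fin (n + 2))} {E A : Submodule F L} (hE : IsSubalg f E)
    (hA : A ≤ frattini f) (h : E ⊔ A = ⊤) : E = ⊤ := by
  by_contra hE'
  obtain ⟨M, hM, hEM⟩ := exists_isMaximalSubalg_ge hE hE'
  exact hM.2.1 (top_le_iff.1 (h ▸ sup_le hEM (hA.trans (sInf_le hM))))

/-- A derivation some power of which maps `L` into the Frattini subalgebra is nilpotent. -/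
theorem IsDerivation.isNilpotent_of_range_pow_le_frattini [FiniteDimensional F L]
    {f : AlternatingMap F L L (Fin (n + 2))} {d : Module.End F L} (hd : IsDerivation f d) {r : ℕ}
    (hr : LinearMap.range (d ^ r) ≤ frattini f) : IsNilpotent d := by
  obtain ⟨k, hk⟩ := Filter.eventually_atTop.1 d.eventually_codisjoint_ker_pow_range_pow
  have htop := (hk (k + r) (Nat.le_add_right k r)).eq_top
  have hker : LinearMap.ker (d ^ (k + r)) ≤ engel d := fun x hx => ⟨k + r, hx⟩
  have hrange : LinearMap.range (d ^ (k + r)) ≤ LinearMap.range (d ^ r) := by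
    rw [add_comm, pow_add]
    exact LinearMap.range_comp_le_range _ _
  have hE : engel d = ⊤ := eq_top_of_sup_eq_top_of_le_frattini hd.isSubalg_engel hr
    (top_le_iff.1 (htop ▸ sup_le_sup hker hrange))
  exact Module.End.isNilpotent_iff_of_finite.2 fun x =>
    mem_engel.1 (hE ▸ Submodule.mem_top)

theorem nes2_le_lowerCentralSeries {f : AlternatingMap F L L (Fin (n + 2))} (hf : IsNLie f)
    {B : Submodule F L} (hB : IsIdeal f B) (s : ℕ) :
    nes2 f B s ≤ (LieModule.lowerCentralSeries F (innerSubalgebra hf hB) L s).toSubmodule := by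
  induction s with
  | zero => simp
  | succ s ih =>
    refine Submodule.span_le.2 ?_
    rintro _ ⟨a, ha, rfl⟩
    obtain ⟨ε, hε⟩ := exists_sign_D_apply f
    have h0 : a 0 ∈ nes2 f B s := ha 0
    have h1 : Fin.tail a 0 ∈ B := ha 1
    have hlie : D f (Fin.tail a) (a 0) ∈
        LieModule.lowerCentralSeries F (innerSubalgebra hf hB) L (s + 1) := by
      rw [LieModule.lowerCentralSeries_succ]
      exact LieSubmodule.lie_mem_lie (x := (⟨_, D_mem_innerSpan f h1⟩ : innerSubalgebra hf hB))
        (LieSubmodule.mem_top _) (ih h0)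
    rw [hε, Fin.cons_self_tail] at hlie
    have := zsmul_mem hlie ((ε⁻¹ : ℤˣ) : ℤ)
    simpa [Units.smul_def, smul_smul] using this

/-- Let `A ⊆ B` be ideals of `L` with `B/A` 2-nilpotently embedded in
`L/A` and `A ⊆ Φ(L)`.  Then `B` is 2-nilpotently embedded in `L`. -/
theorem stmt5 {F : Type*} [Field F] {L : Type*} [AddCommGroup L] [Module F L]
    [FiniteDimensional F L] {n : ℕ} (f : AlternatingMap F L L (Fin (n + 2)))
    (hf : IsNLie f) (A B : Submodule F L)
    (hA : IsIdeal f A) (hB : IsIdeal f B) (hAB : A ≤ B)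
    (hquot : ∃ r, nes2Mod f B A r ≤ A) (hAPhi : A ≤ frattini f) :
    ∃ r, nes2 f B r = ⊥ := by
  obtain ⟨r, hr⟩ := hquot
  have hnil : LieModule.IsNilpotent (innerSubalgebra hf hB) L := by
    refine (LieModule.isNilpotent_iff_forall' (R := F)).2 fun d => ?_
    have hd : (d : Module.End F L) ∈ innerSpan f B := d.2
    refine (isDerivation_of_mem_innerSpan hf hd).isNilpotent_of_range_pow_le_frattini
      (r := r + 1) ?_
    rintro _ ⟨x, rfl⟩
    exact hAPhi (hr (pow_succ_apply_mem_nes2Mod hB hd r x))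
  obtain ⟨s, hs⟩ := (LieModule.isNilpotent_iff F (innerSubalgebra hf hB) L).1 hnil
  refine ⟨s, le_bot_iff.1 ((nes2_le_lowerCentralSeries hf hB s).trans ?_)⟩
  simp [hs]

end NLie
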